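/- arXiv:math/0604083 — 3 statements merged into one kernel-verified Lean document; each statement's English description precedes it below -/
import Mathlib

section
/- Let A be an algebra over K (char 0) with commuting locally nilpotent derivations δ_1, …, δ_s and elements x_1, …, x_s ∈ A with δ_i(x_j) = δ_{ij}. If a ∈ A is written uniquely as a = Σ_{α} x^α λ_α with λ_α ∈ A^δ, then λ_α = φ((δ^α/α!) a), where φ = φ_s ∘ ⋯ ∘ φ_1 with φ_i := Σ_{k≥0} (-1)^k (x_i^k/k!) δ_i^k, and δ^α := δ_1^{α_1} ⋯ δ_s^{α_s}, α! := α_1! ⋯ α_s!. In particular, a = Σ_{α ∈ ℕ^s} x^α φ((δ^α/α!) a) for all a ∈ A. -/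
namespace LocallyNilpotent

section Linear

variable {K A : Type*} [Field K] [Ring A] [Algebra K A]

theorem list_prod_pow_apply_mul_of_apply_eq_zero {s : ℕ} (δ : Fin s → (A →ₗ[K] A))
    (hleib : ∀ i, ∀ a b : A, δ i (a * b) = δ i a * b + a * δ i b) {y : A}
    (hy : ∀ i, δ i y = 0) (β : Fin s → ℕ) (b : A) :
    (List.ofFn fun i => δ i ^ β i).prod (y * b) =
      y * (List.ofFn fun i => δ i ^ β i).prod b := by
  have hpow : ∀ i n (b : A), (δ i ^ n) (y * b) = y * (δ i ^ n) b := by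
    intro i n
    induction n with
    | zero => simp
    | succ n ih => intro b; simp [pow_succ, hleib, hy, ih]
  have hlist : ∀ l : List (A →ₗ[K] A), (∀ f ∈ l, ∀ b, f (y * b) = y * f b) →
      ∀ b, l.prod (y * b) = y * l.prod b := by
    intro l hl
    induction l with
    | nil => simp
    | cons f l ih =>
      intro b
      simp only [List.mem_cons, forall_eq_or_imp] at hl
      simp [ih hl.2, hl.1]
  refine hlist _ (fun f hf => ?_) b
  obtain ⟨i, rfl⟩ := List.mem_ofFn.1 hf
  exact hpow i (β i)

variable {D : A →ₗ[K] A} (hD : ∀ a b : A, D (a * b) = D a * b + a * D b)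
include hD

theorem leibniz_one : D 1 = 0 := by
  simpa using hD 1 1

theorem apply_pow_of_apply_eq_zero {y : A} (hy : D y = 0) (n : ℕ) : D (y ^ n) = 0 := by
  induction n with
  | zero => simpa using leibniz_one hD
  | succ n ih => simp [pow_succ, hD, hy, ih]

theorem apply_list_prod_of_apply_eq_zero (l : List A) (hl : ∀ y ∈ l, D y = 0) :
    D l.prod = 0 := by
  induction l with
  | nil => simpa using leibniz_one hD
  | cons y l ih =>
    simp only [List.mem_cons, forall_eq_or_imp] at hl
    simp [hD, hl.1, ih hl.2]

theorem apply_monomial_mul_of_apply_eq_zero {s : ℕ} {x : Fin s → A} (hx : ∀ i, D (x i) = 0)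
    (α : Fin s → ℕ) {y : A} (hy : D y = 0) :
    D ((List.ofFn fun i => x i ^ α i).prod * y) = 0 := by
  have : D (List.ofFn fun i => x i ^ α i).prod = 0 := by
    refine apply_list_prod_of_apply_eq_zero hD _ fun z hz => ?_
    obtain ⟨i, rfl⟩ := List.mem_ofFn.1 hz
    exact apply_pow_of_apply_eq_zero hD (hx i) _
  simp [hD, hy, this]

variable {x : A} (hx : D x = 1)
include hx

theorem apply_pow_succ (n : ℕ) : D (x ^ (n + 1)) = ((n : K) + 1) • x ^ n := by
  induction n with
  | zero => simp [hx]
  | succ n ih =>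
    rw [pow_succ, hD, ih, hx, smul_mul_assoc, ← pow_succ, mul_one]
    push_cast
    module

theorem pow_apply_pow_mul {y : A} (hy : D y = 0) (m n : ℕ) :
    (D ^ m) (x ^ n * y) = (n.descFactorial m : K) • (x ^ (n - m) * y) := by
  induction m with
  | zero => simp
  | succ m ih =>
    rw [pow_succ', Module.End.mul_apply, ih, map_smul, hD, hy, mul_zero, add_zero,
      Nat.descFactorial_succ, Nat.cast_mul]
    rcases h : n - m with _ | k
    · simp [leibniz_one hD]
    · rw [apply_pow_succ hD hx, show n - (m + 1) = k by omega, smul_mul_assoc]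
      push_cast
      module

theorem pow_succ_apply_mul (n : ℕ) (b : A) :
    (D ^ (n + 1)) (x * b) = x * (D ^ (n + 1)) b + ((n : K) + 1) • (D ^ n) b := by
  induction n with
  | zero => simp [hD, hx, add_comm]
  | succ n ih =>
    have h : ∀ m (c : A), (D ^ (m + 1)) c = D ((D ^ m) c) := fun m c => by
      rw [pow_succ', Module.End.mul_apply]
    rw [h, ih, map_add, hD, map_smul, hx, ← h, ← h, one_mul]
    push_cast
    module

variable [CharZero K]

/-- The truncations of `φ (x * b)`, where `φ = ∑ (-1)^k (x^k / k!) D^k`, telescope. -/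
theorem sum_range_succ_mul (b : A) (N : ℕ) :
    ∑ k ∈ Finset.range (N + 1),
        ((-1 : K) ^ k * ((Nat.factorial k : K)⁻¹)) • (x ^ k * (D ^ k) (x * b)) =
      ((-1 : K) ^ N * ((Nat.factorial N : K)⁻¹)) • (x ^ (N + 1) * (D ^ N) b) := by
  induction N with
  | zero => simp
  | succ N ih =>
    have h1 : (N : K) + 1 ≠ 0 := by exact_mod_cast N.succ_ne_zero
    have h2 : (Nat.factorial N : K) ≠ 0 := by exact_mod_cast N.factorial_ne_zero
    rw [Finset.sum_range_succ, ih, pow_succ_apply_mul hD hx, mul_add, ← mul_assoc, ← pow_succ,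
      mul_smul_comm, smul_add, smul_smul, add_comm, add_assoc, ← add_smul]
    convert add_zero _ using 2
    rw [Nat.factorial_succ]
    push_cast
    convert zero_smul K _ using 2
    field_simp
    ring

/-- A submodule stable under `D` and left multiplication by `x` is generated by the products
`x ^ k * b` of its constants `b`. -/
theorem mem_of_pow_mul_mem (B : Submodule K A) (hBD : ∀ b ∈ B, D b ∈ B)
    (hBx : ∀ b ∈ B, x * b ∈ B) (S : AddSubmonoid A)
    (hS : ∀ k : ℕ, ∀ b ∈ B, D b = 0 → x ^ k * b ∈ S) (n : ℕ) :
    ∀ a ∈ B, (D ^ n) a = 0 → a ∈ S := by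
  have hpow : ∀ (f : A → A), (∀ b ∈ B, f b ∈ B) → ∀ n, ∀ b ∈ B, f^[n] b ∈ B := by
    intro f hf n
    induction n with
    | zero => simp
    | succ n ih => intro b hb; exact ih _ (hf b hb)
  induction n with
  | zero => intro a _ h; simp_all
  | succ n ih =>
    intro a ha h
    have hn : (Nat.factorial n : K) ≠ 0 := by exact_mod_cast n.factorial_ne_zero
    set b := (Nat.factorial n : K)⁻¹ • (D ^ n) a with hb
    have hbB : b ∈ B := B.smul_mem _ (by
      rw [Module.End.pow_apply]; exact hpow D hBD n a ha)
    have hDb : D b = 0 := by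
      rw [hb, map_smul, ← Module.End.mul_apply, ← pow_succ', h, smul_zero]
    have hxb : x ^ n * b ∈ B := by
      have := hpow (x * ·) hBx n b hbB
      rwa [mul_left_iterate] at this
    rw [← sub_add_cancel a (x ^ n * b)]
    refine S.add_mem (ih _ (B.sub_mem ha hxb) ?_) (hS n b hbB hDb)
    rw [map_sub, pow_apply_pow_mul hD hx hDb, Nat.descFactorial_self, Nat.sub_self, pow_zero,
      one_mul, hb, smul_smul, mul_inv_cancel₀ hn, one_smul, sub_self]

variable (hln : ∀ a : A, ∃ n : ℕ, (D ^ n) a = 0) {p : A → A}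
  (hp : ∀ (a : A) (N : ℕ), (D ^ N) a = 0 →
    p a = ∑ k ∈ Finset.range N,
      ((-1 : K) ^ k * ((Nat.factorial k : K)⁻¹)) • (x ^ k * (D ^ k) a))
include hln hp

theorem projection_mul (b : A) : p (x * b) = 0 := by
  obtain ⟨N, hN⟩ := hln b
  have h : (D ^ (N + 1)) b = 0 := by rw [pow_succ', Module.End.mul_apply, hN, map_zero]
  rw [hp (x * b) (N + 1) (by rw [pow_succ_apply_mul hD hx, h, hN]; simp),
    sum_range_succ_mul hD hx, hN, mul_zero, smul_zero]

end Linear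

section Projection

variable {K A : Type*} [Field K] [Ring A] [Algebra K A] {D : A →ₗ[K] A} {x : A} {p : A → A}
  (hp : ∀ (a : A) (N : ℕ), (D ^ N) a = 0 →
    p a = ∑ k ∈ Finset.range N,
      ((-1 : K) ^ k * ((Nat.factorial k : K)⁻¹)) • (x ^ k * (D ^ k) a))
include hp

theorem projection_of_apply_eq_zero {b : A} (hb : D b = 0) : p b = b := by
  rw [hp b 1 (by simpa using hb)]
  simp

theorem projection_add (hln : ∀ a : A, ∃ n : ℕ, (D ^ n) a = 0) (a b : A) :
    p (a + b) = p a + p b := by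
  obtain ⟨m, hm⟩ := hln a
  obtain ⟨n, hn⟩ := hln b
  have ha : (D ^ (m + n)) a = 0 := by
    rw [add_comm, pow_add, Module.End.mul_apply, hm, map_zero]
  have hb : (D ^ (m + n)) b = 0 := by
    rw [pow_add, Module.End.mul_apply, hn, map_zero]
  rw [hp a _ ha, hp b _ hb, hp (a + b) (m + n) (by rw [map_add, ha, hb, add_zero]),
    ← Finset.sum_add_distrib]
  simp only [map_add, mul_add, smul_add]

end Projection

theorem foldl_comp_eq {A : Type*} (l : List (A → A)) (g : A → A) :
    l.foldl (fun g f => f ∘ g) g = l.foldl (fun g f => f ∘ g) id ∘ g := by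
  induction l generalizing g with
  | nil => rfl
  | cons f l ih => rw [List.foldl_cons, List.foldl_cons, ih, ih (f ∘ id)]; rfl

theorem foldl_comp_add {A : Type*} [Add A] (l : List (A → A))
    (hl : ∀ f ∈ l, ∀ a b, f (a + b) = f a + f b) (a b : A) :
    l.foldl (fun g f => f ∘ g) id (a + b) =
      l.foldl (fun g f => f ∘ g) id a + l.foldl (fun g f => f ∘ g) id b := by
  induction l generalizing a b with
  | nil => rfl
  | cons f l ih =>
    simp only [List.mem_cons, forall_eq_or_imp] at hl
    rw [List.foldl_cons, foldl_comp_eq]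
    simp [hl.1, ih hl.2]

section Monomial

variable {K A : Type*} [Field K] [Ring A] [Algebra K A]

theorem list_prod_pow_apply_monomial_mul {s : ℕ} (δ : Fin s → (A →ₗ[K] A))
    (hleib : ∀ i, ∀ a b : A, δ i (a * b) = δ i a * b + a * δ i b) (x : Fin s → A)
    (hx : ∀ i j, δ i (x j) = if i = j then 1 else 0) (α β : Fin s → ℕ) {y : A}
    (hy : ∀ i, δ i y = 0) :
    (List.ofFn fun i => δ i ^ β i).prod ((List.ofFn fun i => x i ^ α i).prod * y) =
      (∏ i, ((α i).descFactorial (β i) : K)) •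
        ((List.ofFn fun i => x i ^ (α i - β i)).prod * y) := by
  induction s with
  | zero => simp
  | succ s ih =>
    have hy' : ∀ j : Fin s, δ j.succ (x 0 ^ α 0) = 0 := fun j =>
      apply_pow_of_apply_eq_zero (hleib _) (by simp [hx]) _
    have h0 : δ 0 ((List.ofFn fun i : Fin s => x i.succ ^ (α i.succ - β i.succ)).prod * y) = 0 :=
      apply_monomial_mul_of_apply_eq_zero (x := fun i : Fin s => x i.succ) (hleib 0)
        (fun i => by simp [hx, (Fin.succ_ne_zero i).symm]) (fun i => α i.succ - β i.succ) (hy 0)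
    simp only [List.ofFn_succ, List.prod_cons, Module.End.mul_apply, mul_assoc]
    rw [list_prod_pow_apply_mul_of_apply_eq_zero (fun i : Fin s => δ i.succ)
        (fun i => hleib _) hy' (fun i => β i.succ),
      ih (fun i => δ i.succ) (fun i => hleib _) (fun i => x i.succ) (fun i j => by simp [hx])
        (fun i => α i.succ) (fun i => β i.succ) (fun i => hy _), mul_smul_comm, map_smul,
      pow_apply_pow_mul (hleib 0) (by simp [hx]) h0, smul_smul, Fin.prod_univ_succ, mul_comm]

variable [CharZero K]

theorem foldl_projection_monomial_mul {s : ℕ} (δ : Fin s → (A →ₗ[K] A))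
    (hleib : ∀ i, ∀ a b : A, δ i (a * b) = δ i a * b + a * δ i b)
    (hln : ∀ i, ∀ a : A, ∃ n : ℕ, ((δ i) ^ n) a = 0) (x : Fin s → A)
    (hx : ∀ i j, δ i (x j) = if i = j then 1 else 0) (φi : Fin s → A → A)
    (hφi : ∀ i, ∀ (a : A) (N : ℕ), ((δ i) ^ N) a = 0 →
      φi i a = ∑ k ∈ Finset.range N,
        ((-1 : K) ^ k * ((Nat.factorial k : K)⁻¹)) • (x i ^ k * ((δ i) ^ k) a))
    (α : Fin s → ℕ) {y : A} (hy : ∀ i, δ i y = 0) :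
    (List.ofFn φi).foldl (fun g f => f ∘ g) id ((List.ofFn fun i => x i ^ α i).prod * y) =
      if α = 0 then y else 0 := by
  induction s generalizing y with
  | zero => simp [Subsingleton.elim α 0]
  | succ s ih =>
    have IH := fun {z : A} => ih (fun i => δ i.succ) (fun i => hleib _) (fun i => hln _)
      (fun i => x i.succ) (fun i j => by simp [hx]) (fun i => φi i.succ) (fun i => hφi _)
      (fun i => α i.succ) (y := z)
    simp only [List.ofFn_succ, List.prod_cons, List.foldl_cons, mul_assoc]
    rw [foldl_comp_eq]
    simp only [Function.comp_apply, id_eq]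
    rcases h : α 0 with _ | k
    · have h0 : δ 0 ((List.ofFn fun i : Fin s => x i.succ ^ α i.succ).prod * y) = 0 :=
        apply_monomial_mul_of_apply_eq_zero (x := fun i : Fin s => x i.succ) (hleib 0)
          (fun i => by simp [hx, (Fin.succ_ne_zero i).symm]) (fun i => α i.succ) (hy 0)
      rw [pow_zero, one_mul, projection_of_apply_eq_zero (hφi 0) h0, IH fun i => hy _]
      simp [funext_iff, Fin.forall_fin_succ, h]
    · rw [pow_succ', mul_assoc, projection_mul (hleib 0) (by simp [hx]) (hln 0) (hφi 0)]
      have hα : α ≠ 0 := fun h0 => by simp [h0] at h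
      simpa [hα] using IH (z := 0) (by simp)

/-- A submodule stable under the `δ i` and left multiplication by the `x i` is generated by the
products of monomials in `x` with its constants. -/
theorem mem_of_monomial_mul_mem {s : ℕ} (δ : Fin s → (A →ₗ[K] A))
    (hleib : ∀ i, ∀ a b : A, δ i (a * b) = δ i a * b + a * δ i b)
    (hcomm : ∀ i j, ∀ a : A, δ i (δ j a) = δ j (δ i a))
    (hln : ∀ i, ∀ a : A, ∃ n : ℕ, ((δ i) ^ n) a = 0) (x : Fin s → A)
    (hx : ∀ i j, δ i (x j) = if i = j then 1 else 0) (B : Submodule K A)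
    (hBδ : ∀ i, ∀ b ∈ B, δ i b ∈ B) (hBx : ∀ i, ∀ b ∈ B, x i * b ∈ B) (S : AddSubmonoid A)
    (hS : ∀ α : Fin s → ℕ, ∀ b ∈ B, (∀ i, δ i b = 0) →
      (List.ofFn fun i => x i ^ α i).prod * b ∈ S) {a : A} (ha : a ∈ B) : a ∈ S := by
  induction s generalizing B S a with
  | zero => simpa using hS 0 a ha (fun i => i.elim0)
  | succ s ih =>
    obtain ⟨n, hn⟩ := hln 0 a
    refine mem_of_pow_mul_mem (hleib 0) (by simp [hx] : δ 0 (x 0) = 1) B (hBδ 0) (hBx 0) S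
      (fun k b hb h0 => ?_) n a ha hn
    refine ih (fun i => δ i.succ) (fun i => hleib _) (fun i j => hcomm _ _) (fun i => hln _)
      (fun i => x i.succ) (fun i j => by simp [hx]) (B ⊓ LinearMap.ker (δ 0)) ?_ ?_
      (S.comap (AddMonoidHom.mulLeft (x 0 ^ k))) ?_ ⟨hb, h0⟩
    · rintro i c ⟨hc, hc0⟩
      refine ⟨hBδ _ c hc, ?_⟩
      simp only [SetLike.mem_coe, LinearMap.mem_ker] at hc0 ⊢
      rw [hcomm, hc0, map_zero]
    · rintro i c ⟨hc, hc0⟩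
      refine ⟨hBx _ c hc, ?_⟩
      simp only [SetLike.mem_coe, LinearMap.mem_ker] at hc0 ⊢
      simp [hleib, hc0, hx, (Fin.succ_ne_zero i).symm]
    · rintro α c ⟨hc, hc0⟩ hcs
      have := hS (Fin.cons k α) c hc (Fin.forall_fin_succ.2 ⟨hc0, hcs⟩)
      simpa [List.ofFn_succ, mul_assoc] using this

end Monomial

end LocallyNilpotent


/-- if `a = Σ_α x^α λ_α` with `λ_α ∈ A^δ`, then
`λ_α = φ ((δ^α/α!) a)` where `φ = φ_s ∘ ⋯ ∘ φ_1`,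
`φ_i := Σ_{k≥0} (-1)^k (x_i^k/k!) δ_i^k`.  In particular
`a = Σ_α x^α φ ((δ^α/α!) a)` for all `a ∈ A`. -/
theorem stmt7 {K A : Type*} [Field K] [CharZero K] [Ring A] [Algebra K A]
    {s : ℕ} (δ : Fin s → (A →ₗ[K] A))
    (hleib : ∀ i, ∀ a b : A, δ i (a * b) = δ i a * b + a * δ i b)
    (hcomm : ∀ i j, ∀ a : A, δ i (δ j a) = δ j (δ i a))
    (hln : ∀ i, ∀ a : A, ∃ n : ℕ, ((δ i) ^ n) a = 0)
    (x : Fin s → A)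
    (hx : ∀ i j, δ i (x j) = if i = j then 1 else 0)
    (φi : Fin s → A → A)
    (hφi : ∀ i, ∀ (a : A) (N : ℕ), ((δ i) ^ N) a = 0 →
      φi i a = ∑ k ∈ Finset.range N,
        ((-1 : K) ^ k * ((Nat.factorial k : K)⁻¹)) • (x i ^ k * ((δ i) ^ k) a))
    (φ : A → A)
    (hφ : φ = (List.ofFn φi).foldl (fun g f => f ∘ g) id) :
    (∀ (a : A) (c : (Fin s → ℕ) →₀ A),
      (∀ α i, δ i (c α) = 0) →
      a = c.sum (fun α lam => (List.ofFn fun i => x i ^ α i).prod * lam) →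
      ∀ α : Fin s → ℕ,
        c α = φ ((∏ i, (Nat.factorial (α i) : K))⁻¹ •
          ((List.ofFn fun i => (δ i) ^ α i).prod a))) ∧
    (∀ a : A, ∃ c : (Fin s → ℕ) →₀ A,
      (∀ α : Fin s → ℕ,
        c α = φ ((∏ i, (Nat.factorial (α i) : K))⁻¹ •
          ((List.ofFn fun i => (δ i) ^ α i).prod a))) ∧
      a = c.sum fun α lam => (List.ofFn fun i => x i ^ α i).prod * lam) := by
  have hadd : ∀ a b, φ (a + b) = φ a + φ b := by
    rw [hφ]
    refine LocallyNilpotent.foldl_comp_add _ fun f hf => ?_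
    obtain ⟨i, rfl⟩ := List.mem_ofFn.1 hf
    exact LocallyNilpotent.projection_add (hφi i) (hln i)
  have hmon : ∀ (α β : Fin s → ℕ) (y : A), (∀ i, δ i y = 0) →
      φ ((∏ i, (Nat.factorial (β i) : K))⁻¹ • ((List.ofFn fun i => δ i ^ β i).prod
        ((List.ofFn fun i => x i ^ α i).prod * y))) = if α = β then y else 0 := by
    intro α β y hy
    rw [LocallyNilpotent.list_prod_pow_apply_monomial_mul δ hleib x hx α β hy, smul_smul,
      ← mul_smul_comm, hφ, LocallyNilpotent.foldl_projection_monomial_mul δ hleib hln x hx φi hφi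
        (fun i => α i - β i) (fun i => by rw [map_smul, hy, smul_zero])]
    by_cases hle : β ≤ α
    · rcases eq_or_ne α β with rfl | hne
      · have h : ∏ i, (Nat.factorial (α i) : K) ≠ 0 :=
          Finset.prod_ne_zero_iff.2 fun i _ => by exact_mod_cast (α i).factorial_ne_zero
        simp [Nat.descFactorial_self, h, funext_iff]
      · have h : ¬ (fun i => α i - β i) = 0 := fun h =>
          hne (le_antisymm (fun i => Nat.sub_eq_zero_iff_le.1 (congrFun h i)) hle)
        simp [h, hne]
    · obtain ⟨i, hi⟩ : ∃ i, α i < β i := by simpa [Pi.le_def] using hle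
      have h : ∏ i, ((α i).descFactorial (β i) : K) = 0 :=
        Finset.prod_eq_zero (Finset.mem_univ i) (by simp [Nat.descFactorial_eq_zero_iff_lt, hi])
      have hne : α ≠ β := fun h => hle h.ge
      simp [h, hne]
  have hcoeff : ∀ (a : A) (c : (Fin s → ℕ) →₀ A), (∀ α i, δ i (c α) = 0) →
      a = c.sum (fun α lam => (List.ofFn fun i => x i ^ α i).prod * lam) →
      ∀ α : Fin s → ℕ, c α = φ ((∏ i, (Nat.factorial (α i) : K))⁻¹ •
        ((List.ofFn fun i => (δ i) ^ α i).prod a)) := by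
    rintro a c hc rfl β
    let Φ : A →+ A := AddMonoidHom.mk' φ hadd
    change c β = Φ _
    rw [Finsupp.sum, map_sum, Finset.smul_sum, map_sum]
    change c β = ∑ α ∈ c.support, φ _
    rw [Finset.sum_congr rfl fun α _ => hmon α β (c α) (hc α)]
    simp only [Finset.sum_ite_eq', Finsupp.mem_support_iff, ne_eq]
    split_ifs with h <;> simp_all
  refine ⟨hcoeff, fun a => ?_⟩
  let S : AddSubmonoid A :=
    { carrier := {a | ∃ c : (Fin s → ℕ) →₀ A, (∀ α i, δ i (c α) = 0) ∧
        a = c.sum fun α lam => (List.ofFn fun i => x i ^ α i).prod * lam}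
      zero_mem' := ⟨0, by simp, by simp⟩
      add_mem' := by
        rintro _ _ ⟨c, hc, rfl⟩ ⟨d, hd, rfl⟩
        exact ⟨c + d, by simp [hc, hd],
          (Finsupp.sum_add_index' (fun _ => mul_zero _) (fun _ => mul_add _)).symm⟩ }
  have haS : a ∈ S := by
    refine LocallyNilpotent.mem_of_monomial_mul_mem δ hleib hcomm hln x hx ⊤ (by simp) (by simp)
      S (fun α b _ hb => ?_) Submodule.mem_top
    refine ⟨Finsupp.single α b, fun β i => ?_, by simp⟩
    rw [Finsupp.single_apply]
    split_ifs <;> simp [hb]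
  obtain ⟨c, hc, hac⟩ := haS
  exact ⟨c, hcoeff a c hc hac, hac⟩
end

section
/- Let A be a commutative algebra over a field K of characteristic zero, δ_1, …, δ_s commuting locally nilpotent K-derivations of A, x_1, …, x_s ∈ A with δ_i(x_j) = δ_{ij}, and φ := φ_s ∘ ⋯ ∘ φ_1 where φ_i := Σ_{k≥0} (-1)^k (x_i^k/k!) δ_i^k. Then φ : A → A^δ is a surjective K-algebra homomorphism with kernel equal to the ideal (x_1, …, x_s); in particular A^δ ≅ A/(x_1, …, x_s). -/
/-- The Taylor polynomial `∑ k, (D ^ k a / k!) X ^ k` of `a` along a locally nilpotent map `D`. -/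
noncomputable def taylorAlong {K A : Type*} [Field K] [CommRing A] [Algebra K A]
    (D : A →ₗ[K] A) (hD : ∀ a : A, ∃ n : ℕ, (D ^ n) a = 0) (a : A) : Polynomial A :=
  ∑ k ∈ Finset.range (hD a).choose, Polynomial.monomial k ((Nat.factorial k : K)⁻¹ • (D ^ k) a)

section SingleDerivation

variable {K A : Type*} [Field K] [CommRing A] [Algebra K A] {D : A →ₗ[K] A}

theorem pow_apply_eq_zero_of_le {a : A} {m n : ℕ} (h : (D ^ m) a = 0) (hmn : m ≤ n) :
    (D ^ n) a = 0 := by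
  obtain ⟨d, rfl⟩ := Nat.exists_eq_add_of_le hmn
  rw [add_comm, pow_add, Module.End.mul_apply, h, map_zero]

theorem coeff_taylorAlong (hD : ∀ a : A, ∃ n : ℕ, (D ^ n) a = 0) (a : A) (k : ℕ) :
    (taylorAlong D hD a).coeff k = (Nat.factorial k : K)⁻¹ • (D ^ k) a := by
  simp only [taylorAlong, Polynomial.finsetSum_coeff, Polynomial.coeff_monomial,
    Finset.sum_ite_eq', Finset.mem_range]
  split_ifs with h
  · rfl
  · rw [pow_apply_eq_zero_of_le (hD a).choose_spec (not_lt.mp h), smul_zero]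

theorem eval_taylorAlong (hD : ∀ a : A, ∃ n : ℕ, (D ^ n) a = 0) (x a : A) {N : ℕ}
    (hN : (D ^ N) a = 0) :
    (taylorAlong D hD a).eval (-x) = ∑ k ∈ Finset.range N,
      ((-1 : K) ^ k * ((Nat.factorial k : K)⁻¹)) • (x ^ k * (D ^ k) a) := by
  have h : (taylorAlong D hD a).degree < N := by
    rw [Polynomial.degree_lt_iff_coeff_zero]
    intro m hm
    rw [coeff_taylorAlong, pow_apply_eq_zero_of_le hN hm, smul_zero]
  rw [Polynomial.eval_eq_sum, Polynomial.sum_def]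
  have hsub : (taylorAlong D hD a).support ⊆ Finset.range N := fun k hk => by
    by_contra hkN
    rw [Polynomial.mem_support_iff] at hk
    exact hk ((Polynomial.degree_lt_iff_coeff_zero _ _).mp h k
      (not_lt.mp fun hlt => hkN (Finset.mem_range.mpr hlt)))
  rw [Finset.sum_subset hsub fun k _ hk => by
    rw [Polynomial.notMem_support_iff.mp hk, zero_mul]]
  refine Finset.sum_congr rfl fun k _ => ?_
  rw [coeff_taylorAlong, neg_pow]
  simp only [Algebra.smul_def, map_mul, map_pow, map_neg, map_one]
  ring

theorem map_one_eq_zero_of_leibniz (hleib : ∀ a b : A, D (a * b) = D a * b + a * D b) :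
    D 1 = 0 := by
  simpa using hleib 1 1

theorem map_pow_succ_of_leibniz (hleib : ∀ a b : A, D (a * b) = D a * b + a * D b)
    (x : A) (n : ℕ) : D (x ^ (n + 1)) = (n + 1 : ℕ) * x ^ n * D x := by
  induction n with
  | zero => simp
  | succ n ih =>
    rw [pow_succ, hleib, ih]
    push_cast
    ring

theorem pow_apply_mul_of_leibniz (hleib : ∀ a b : A, D (a * b) = D a * b + a * D b)
    (a b : A) (n : ℕ) : (D ^ n) (a * b) =
      ∑ ij ∈ Finset.HasAntidiagonal.antidiagonal n, n.choose ij.1 • ((D ^ ij.1) a * (D ^ ij.2) b) := by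
  induction n with
  | zero => simp
  | succ n ih =>
    rw [Finset.sum_antidiagonal_choose_succ_nsmul (M := A)
      (fun i j => (D ^ i) a * (D ^ j) b) n]
    simp only [pow_succ', Module.End.mul_apply] at ih ⊢
    simp only [ih, map_sum, map_nsmul, hleib, smul_add, Finset.sum_add_distrib]
    rw [add_comm]
    refine congrArg₂ (· + ·) rfl (Finset.sum_congr rfl fun ij hij => ?_)
    rw [Nat.choose_symm_of_eq_add (Finset.HasAntidiagonal.mem_antidiagonal.mp hij).symm]

variable [CharZero K]

theorem taylorAlong_mul (hD : ∀ a : A, ∃ n : ℕ, (D ^ n) a = 0)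
    (hleib : ∀ a b : A, D (a * b) = D a * b + a * D b) (a b : A) :
    taylorAlong D hD (a * b) = taylorAlong D hD a * taylorAlong D hD b := by
  ext n
  rw [Polynomial.coeff_mul, coeff_taylorAlong, pow_apply_mul_of_leibniz hleib, Finset.smul_sum]
  refine Finset.sum_congr rfl fun ij hij => ?_
  rw [coeff_taylorAlong, coeff_taylorAlong, smul_mul_smul_comm, ← Nat.cast_smul_eq_nsmul K,
    smul_smul]
  congr 1
  obtain rfl := Finset.HasAntidiagonal.mem_antidiagonal.mp hij
  have h := Nat.choose_mul_factorial_mul_factorial (Nat.le_add_right ij.1 ij.2)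
  rw [Nat.add_sub_cancel_left] at h
  have h' : (((ij.1 + ij.2).choose ij.1 : K)) * (ij.1.factorial : K) * (ij.2.factorial : K)
      = ((ij.1 + ij.2).factorial : K) := by exact_mod_cast h
  have h1 : (ij.1.factorial : K) ≠ 0 := Nat.cast_ne_zero.mpr (Nat.factorial_ne_zero _)
  have h2 : (ij.2.factorial : K) ≠ 0 := Nat.cast_ne_zero.mpr (Nat.factorial_ne_zero _)
  have h3 : ((ij.1 + ij.2).factorial : K) ≠ 0 := Nat.cast_ne_zero.mpr (Nat.factorial_ne_zero _)
  field_simp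
  linear_combination h'

/-- The Dixmier map `a ↦ ∑ k, (-1) ^ k (x ^ k / k!) D ^ k a` of a locally nilpotent
derivation `D`. -/
noncomputable def dixmierMap (D : A →ₗ[K] A) (hD : ∀ a : A, ∃ n : ℕ, (D ^ n) a = 0)
    (hleib : ∀ a b : A, D (a * b) = D a * b + a * D b) (x : A) : A →ₐ[K] A :=
  AlgHom.ofLinearMap
    { toFun := fun a => (taylorAlong D hD a).eval (-x)
      map_add' := fun a b => by
        rw [← Polynomial.eval_add]
        congr 1
        ext k
        simp only [Polynomial.coeff_add, coeff_taylorAlong, map_add, smul_add]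
      map_smul' := fun c a => by
        rw [RingHom.id_apply, ← Polynomial.eval_smul]
        congr 1
        ext k
        simp only [Polynomial.coeff_smul, coeff_taylorAlong, map_smul, smul_comm c] }
    (by
      have h : (D ^ 1) (1 : A) = 0 := by
        rw [pow_one, map_one_eq_zero_of_leibniz hleib]
      simpa using eval_taylorAlong hD x 1 h)
    (fun a b => by
      simp only [LinearMap.coe_mk, AddHom.coe_mk, taylorAlong_mul hD hleib, Polynomial.eval_mul])

variable (hD : ∀ a : A, ∃ n : ℕ, (D ^ n) a = 0)
  (hleib : ∀ a b : A, D (a * b) = D a * b + a * D b)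

theorem dixmierMap_apply (x a : A) {N : ℕ} (hN : (D ^ N) a = 0) :
    dixmierMap D hD hleib x a = ∑ k ∈ Finset.range N,
      ((-1 : K) ^ k * ((Nat.factorial k : K)⁻¹)) • (x ^ k * (D ^ k) a) :=
  eval_taylorAlong hD x a hN

theorem dixmierMap_of_map_eq_zero (x : A) {a : A} (ha : D a = 0) :
    dixmierMap D hD hleib x a = a := by
  rw [dixmierMap_apply hD hleib x a (N := 1) (by rwa [pow_one])]
  simp

theorem dixmierMap_self {x : A} (hx : D x = 1) : dixmierMap D hD hleib x x = 0 := by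
  have h : (D ^ 2) x = 0 := by
    rw [pow_two, Module.End.mul_apply, hx, map_one_eq_zero_of_leibniz hleib]
  rw [dixmierMap_apply hD hleib x x h]
  simp [Finset.sum_range_succ, hx]

theorem map_dixmierMap {x : A} (hx : D x = 1) (a : A) : D (dixmierMap D hD hleib x a) = 0 := by
  have telescope : ∀ n : ℕ, D (∑ k ∈ Finset.range (n + 1),
      ((-1 : K) ^ k * ((Nat.factorial k : K)⁻¹)) • (x ^ k * (D ^ k) a)) =
      ((-1 : K) ^ n * ((Nat.factorial n : K)⁻¹)) • (x ^ n * (D ^ (n + 1)) a) := by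
    intro n
    induction n with
    | zero => simp
    | succ n ih =>
      rw [Finset.sum_range_succ, map_add, ih, map_smul, hleib, map_pow_succ_of_leibniz hleib, hx,
        ← Module.End.mul_apply, ← pow_succ', smul_add, ← add_assoc, add_eq_right, mul_one,
        mul_assoc, ← nsmul_eq_mul, ← Nat.cast_smul_eq_nsmul K, smul_smul, ← add_smul]
      convert zero_smul K _
      have h1 : (n.factorial : K) ≠ 0 := Nat.cast_ne_zero.mpr (Nat.factorial_ne_zero _)
      have h2 : ((n + 1 : ℕ) : K) ≠ 0 := Nat.cast_ne_zero.mpr n.succ_ne_zero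
      rw [Nat.factorial_succ, Nat.cast_mul]
      field_simp
      ring
  obtain ⟨N, hN⟩ := hD a
  have hN' := pow_apply_eq_zero_of_le hN N.le_succ
  rw [dixmierMap_apply hD hleib x a hN', telescope, hN', mul_zero, smul_zero]

theorem map_dixmierMap_eq_zero_of_commute {D' : A →ₗ[K] A}
    (hleib' : ∀ a b : A, D' (a * b) = D' a * b + a * D' b)
    (hcomm : ∀ a : A, D' (D a) = D (D' a)) {x a : A} (hx : D' x = 0) (ha : D' a = 0) :
    D' (dixmierMap D hD hleib x a) = 0 := by
  obtain ⟨N, hN⟩ := hD a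
  have hpow : ∀ k : ℕ, D' ((D ^ k) a) = 0 := fun k => by
    induction k with
    | zero => simpa using ha
    | succ k ih => rw [pow_succ', Module.End.mul_apply, hcomm, ih, map_zero]
  have hxpow : ∀ k : ℕ, D' (x ^ k) = 0 := fun k => by
    cases k with
    | zero => rw [pow_zero, map_one_eq_zero_of_leibniz hleib']
    | succ k => rw [map_pow_succ_of_leibniz hleib', hx, mul_zero]
  rw [dixmierMap_apply hD hleib x a hN, map_sum]
  refine Finset.sum_eq_zero fun k _ => ?_
  rw [map_smul, hleib', hpow, hxpow, zero_mul, mul_zero, add_zero, smul_zero]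

theorem sub_dixmierMap_mem {x : A} {I : Ideal A} (hx : x ∈ I) (a : A) :
    a - dixmierMap D hD hleib x a ∈ I := by
  obtain ⟨N, hN⟩ := hD a
  rw [dixmierMap_apply hD hleib x a (pow_apply_eq_zero_of_le hN N.le_succ),
    Finset.sum_range_succ']
  simp only [pow_zero, Nat.factorial_zero, Nat.cast_one, inv_one, mul_one, one_smul, one_mul,
    Module.End.one_apply, sub_add_cancel_right]
  refine I.neg_mem (I.sum_mem fun k _ => ?_)
  rw [Algebra.smul_def]
  exact I.mul_mem_left _ (I.mul_mem_right _ (I.pow_mem_of_mem hx _ k.succ_pos))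

end SingleDerivation

/-- The composite of a list of algebra endomorphisms, the head of the list acting first. -/
def composeEndos {K A : Type*} [CommSemiring K] [Semiring A] [Algebra K A] :
    List (A →ₐ[K] A) → (A →ₐ[K] A)
  | [] => AlgHom.id K A
  | f :: l => (composeEndos l).comp f

theorem foldl_comp_coe_eq {K A : Type*} [CommSemiring K] [Semiring A] [Algebra K A]
    (l : List (A →ₐ[K] A)) (g : A → A) :
    (l.map fun f : A →ₐ[K] A => (f : A → A)).foldl (fun g f => f ∘ g) g = composeEndos l ∘ g := by
  induction l generalizing g with
  | nil => rfl
  | cons f l ih => rw [List.map_cons, List.foldl_cons, ih]; rfl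

/-- for commutative `A`, `φ = φ_s ∘ ⋯ ∘ φ_1 : A → A^δ` is a
surjective `K`-algebra homomorphism with kernel the ideal `(x_1, …, x_s)`;
in particular `A^δ ≅ A/(x_1, …, x_s)`. -/
theorem stmt10 {K A : Type*} [Field K] [CharZero K] [CommRing A] [Algebra K A]
    {s : ℕ} (δ : Fin s → (A →ₗ[K] A))
    (hleib : ∀ i, ∀ a b : A, δ i (a * b) = δ i a * b + a * δ i b)
    (hcomm : ∀ i j, ∀ a : A, δ i (δ j a) = δ j (δ i a))
    (hln : ∀ i, ∀ a : A, ∃ n : ℕ, ((δ i) ^ n) a = 0)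
    (x : Fin s → A)
    (hx : ∀ i j, δ i (x j) = if i = j then 1 else 0)
    (φi : Fin s → A → A)
    (hφi : ∀ i, ∀ (a : A) (N : ℕ), ((δ i) ^ N) a = 0 →
      φi i a = ∑ k ∈ Finset.range N,
        ((-1 : K) ^ k * ((Nat.factorial k : K)⁻¹)) • (x i ^ k * ((δ i) ^ k) a))
    (φ : A → A)
    (hφ : φ = (List.ofFn φi).foldl (fun g f => f ∘ g) id) :
    (∃ f : A →ₐ[K] A, ∀ a : A, f a = φ a) ∧
    Set.range φ = {a : A | ∀ i, δ i a = 0} ∧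
    (∀ a : A, (∀ i, δ i a = 0) → φ a = a) ∧
    (∀ a : A, φ a = 0 ↔ a ∈ Ideal.span (Set.range x)) := by
  let Φ : Fin s → (A →ₐ[K] A) := fun i => dixmierMap (δ i) (hln i) (hleib i) (x i)
  have hΦ : φi = fun i => (Φ i : A → A) := by
    funext i a
    obtain ⟨N, hN⟩ := hln i a
    rw [hφi i a N hN, dixmierMap_apply (hln i) (hleib i) (x i) a hN]
  let F : List (Fin s) → (A →ₐ[K] A) := fun l => composeEndos (l.map Φ)
  have hF : ∀ a, F (List.finRange s) a = φ a := fun a => by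
    have h := foldl_comp_coe_eq ((List.finRange s).map Φ) id
    rw [List.map_map] at h
    rw [hφ, List.ofFn_eq_map, hΦ]
    exact (congrFun h a).symm
  have hF_cons : ∀ i l a, F (i :: l) a = F l (Φ i a) := fun _ _ _ => rfl
  have hF_nil : ∀ a, F [] a = a := fun _ => rfl
  have hF_inv : ∀ l j a, j ∈ l ∨ δ j a = 0 → δ j (F l a) = 0 := by
    intro l j
    induction l with
    | nil => intro a h; simpa [hF_nil] using h
    | cons i l ih =>
      intro a h
      rw [hF_cons]
      refine ih _ ?_
      by_cases hij : j = i
      · subst hij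
        exact Or.inr (map_dixmierMap _ _ (by simp [hx]) a)
      · refine h.imp (fun h => (List.mem_cons.mp h).resolve_left hij) fun h => ?_
        exact map_dixmierMap_eq_zero_of_commute _ _ (hleib j) (hcomm j i)
          (by rw [hx, if_neg hij]) h
  have hF_fix : ∀ l a, (∀ i, δ i a = 0) → F l a = a := by
    intro l a ha
    induction l with
    | nil => exact hF_nil a
    | cons i l ih =>
      have h : Φ i a = a := dixmierMap_of_map_eq_zero _ _ _ (ha i)
      rw [hF_cons, h, ih]
  have hF_sub : ∀ l a, a - F l a ∈ Ideal.span (Set.range x) := by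
    intro l
    induction l with
    | nil => intro a; simp [hF_nil]
    | cons i l ih =>
      intro a
      rw [hF_cons, ← sub_add_sub_cancel a (Φ i a)]
      exact add_mem (sub_dixmierMap_mem _ _ (Ideal.subset_span (Set.mem_range_self i)) a) (ih _)
  have hF_x : ∀ l j, j ∈ l → F l (x j) = 0 := by
    intro l j hj
    induction l with
    | nil => simp at hj
    | cons i l ih =>
      rw [hF_cons]
      by_cases hij : i = j
      · subst hij
        have h : Φ i (x i) = 0 := dixmierMap_self _ _ (by simp [hx])
        rw [h, map_zero]
      · have h : Φ i (x j) = x j :=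
          dixmierMap_of_map_eq_zero _ _ _ (by rw [hx, if_neg hij])
        rw [h, ih ((List.mem_cons.mp hj).resolve_left (Ne.symm hij))]
  have hfix : ∀ a : A, (∀ i, δ i a = 0) → φ a = a := fun a ha => by
    rw [← hF, hF_fix _ a ha]
  refine ⟨⟨F (List.finRange s), hF⟩, ?_, hfix, fun a => ⟨fun ha => ?_, fun ha => ?_⟩⟩
  · ext a
    constructor
    · rintro ⟨b, rfl⟩ i
      rw [← hF]
      exact hF_inv _ i b (Or.inl (List.mem_finRange i))
    · exact fun ha => ⟨a, hfix a ha⟩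
  · have h := hF_sub (List.finRange s) a
    rwa [hF, ha, sub_zero] at h
  · have hle : Ideal.span (Set.range x) ≤ RingHom.ker (F (List.finRange s)) := by
      rw [Ideal.span_le]
      rintro _ ⟨j, rfl⟩
      exact hF_x _ j (List.mem_finRange j)
    rw [← hF]
    exact hle ha
end

section
/- Let A be an algebra over a field K of characteristic zero and σ ∈ Aut_K(A) an automorphism such that the map σ − id_A is locally nilpotent. Then δ := Σ_{k≥1} (-1)^{k+1} (σ − id_A)^k / k is a locally nilpotent K-derivation of A, and σ = e^δ := Σ_{k≥0} δ^k/k!. -/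
open Polynomial in
theorem polynomial_eq_zero_of_eval_natCast_eq_zero {K A : Type*} [Field K] [CharZero K] [Ring A]
    [Algebra K A] (p : A[X]) (hp : ∀ n : ℕ, p.eval (n : A) = 0) : p = 0 := by
  ext i
  rw [coeff_zero, ← Module.forall_dual_apply_eq_zero_iff K]
  intro φ
  set q : K[X] := ∑ j ∈ Finset.range (p.natDegree + 1), monomial j (φ (p.coeff j)) with hq
  have hq0 : q = 0 := by
    refine eq_zero_of_infinite_isRoot q
      ((Set.infinite_range_of_injective (Nat.cast_injective (R := K))).mono ?_)
    rintro _ ⟨n, rfl⟩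
    have h := congrArg φ (hp n)
    rw [eval_eq_sum_range, map_sum, map_zero] at h
    rw [Set.mem_ofPred_eq, IsRoot, hq, eval_finsetSum, ← h]
    refine Finset.sum_congr rfl fun j _ => ?_
    have : p.coeff j * (n : A) ^ j = ((n : K) ^ j) • p.coeff j := by
      rw [Algebra.smul_def, map_pow, map_natCast, ← Nat.cast_pow, Nat.cast_comm]
    rw [this, map_smul, eval_monomial, smul_eq_mul, mul_comm]
  by_cases hi : i < p.natDegree + 1
  · have h := congrArg (fun r : K[X] => r.coeff i) hq0
    simpa [hq, finsetSum_coeff, coeff_monomial, Nat.lt_succ_iff.mp hi] using h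
  · rw [coeff_eq_zero_of_natDegree_lt (by omega), map_zero]

open Polynomial in
theorem eval_natCast_mul_of_ring {A : Type*} [Ring A] (p q : A[X]) (n : ℕ) :
    (p * q).eval (n : A) = p.eval (n : A) * q.eval (n : A) :=
  eval₂_mul_noncomm _ _ fun _ => (Nat.cast_commute n _).symm

open Polynomial in
theorem eval_natCast_taylor_natCast {A : Type*} [Ring A] (p : A[X]) (m n : ℕ) :
    (taylor (n : A) p).eval (m : A) = p.eval ((m + n : ℕ) : A) := by
  induction p using Polynomial.induction_on' with
  | add p q hp hq => rw [map_add, eval_add, eval_add, hp, hq]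
  | monomial k a =>
    have h : (X + C (n : A)) ^ k = ((X + C n) ^ k : ℕ[X]).map (Nat.castRingHom A) := by
      simp
    rw [taylor_monomial, h, eval_natCast_mul_of_ring, eval_natCast_map, eval_C, eval_monomial]
    simp

open Polynomial in
theorem coeff_one_descPochhammer_succ (R : Type*) [CommRing R] (k : ℕ) :
    (descPochhammer R (k + 1)).coeff 1 = (-1) ^ k * (k.factorial : R) := by
  induction k with
  | zero => simp
  | succ k ih =>
    rw [descPochhammer_succ_right, mul_coeff_one, ih, coeff_zero_eq_eval_zero,
      descPochhammer_ne_zero_eval_zero R k.succ_ne_zero]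
    simp [Nat.factorial_succ, coeff_X, coeff_natCast_ite]
    ring

/-- The polynomial `p` interpolates the orbit `n ↦ σ ^ n a`. -/
def InterpolatesOrbit {K A : Type*} [Field K] [Ring A] [Algebra K A] (σ : A ≃ₐ[K] A) (a : A)
    (p : Polynomial A) : Prop :=
  ∀ n : ℕ, p.eval (n : A) = (σ ^ n) a

theorem pow_apply_eq_sum_choose {K A : Type*} [Field K] [Ring A] [Algebra K A]
    (σ : A ≃ₐ[K] A) (a : A) (N n : ℕ) (hN : (fun b : A => σ b - b)^[N] a = 0) :
    (σ ^ n) a = ∑ k ∈ Finset.range N, (n.choose k : K) • (fun b : A => σ b - b)^[k] a := by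
  set D : Module.End K A := σ.toLinearMap - 1 with hD
  have hDk : ∀ k, (fun b : A => σ b - b)^[k] a = (D ^ k) a := fun k => by
    rw [Module.End.pow_apply]; rfl
  have hvan : ∀ k, N ≤ k → (D ^ k) a = 0 := fun k hk => by
    rw [hDk] at hN
    rw [← Nat.sub_add_cancel hk, pow_add, Module.End.mul_apply, hN, map_zero]
  have hσ : (σ ^ n) a = ((D + 1) ^ n) a := by
    rw [hD, sub_add_cancel, Module.End.pow_apply, AlgEquiv.coe_pow]; rfl
  have hsum : (σ ^ n) a = ∑ k ∈ Finset.range (n + 1), (n.choose k : K) • (D ^ k) a := by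
    rw [hσ, (Commute.one_right D).add_pow, LinearMap.sum_apply]
    refine Finset.sum_congr rfl fun k _ => ?_
    rw [one_pow, mul_one, ← Nat.cast_comm, ← nsmul_eq_mul, LinearMap.smul_apply,
      Nat.cast_smul_eq_nsmul]
  simp only [hDk]
  rw [hsum]
  trans ∑ k ∈ Finset.range (max N (n + 1)), (n.choose k : K) • (D ^ k) a
  · refine Finset.sum_subset (Finset.range_mono (le_max_right _ _)) fun k _ hk => ?_
    rw [Nat.choose_eq_zero_of_lt (by simpa using hk), Nat.cast_zero, zero_smul]
  · refine (Finset.sum_subset (Finset.range_mono (le_max_left _ _)) fun k _ hk => ?_).symm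
    rw [hvan k (by simpa using hk), smul_zero]

open Polynomial in
theorem exists_interpolatesOrbit {K A : Type*} [Field K] [CharZero K] [Ring A] [Algebra K A]
    (σ : A ≃ₐ[K] A) (a : A) (N : ℕ) (hN : (fun b : A => σ b - b)^[N] a = 0) :
    ∃ p : A[X], InterpolatesOrbit σ a p ∧
      p.coeff 1 = ∑ k ∈ Finset.Icc 1 N,
        ((-1 : K) ^ (k + 1) * ((k : K)⁻¹)) • (fun b : A => σ b - b)^[k] a := by
  refine ⟨∑ k ∈ Finset.range N,
    (((k.factorial : K)⁻¹) • descPochhammer K k).map (algebraMap K A) *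
      C ((fun b : A => σ b - b)^[k] a), fun n => ?_, ?_⟩
  · rw [pow_apply_eq_sum_choose σ a N n hN, eval_finsetSum]
    refine Finset.sum_congr rfl fun k _ => ?_
    rw [eval_natCast_mul_of_ring, eval_natCast_map, eval_C, ← Algebra.smul_def, eval_smul,
      descPochhammer_eval_eq_descFactorial, Nat.descFactorial_eq_factorial_mul_choose,
      Nat.cast_mul, smul_eq_mul, inv_mul_cancel_left₀ (Nat.cast_ne_zero.2 k.factorial_ne_zero)]
  · rw [finsetSum_coeff]
    simp only [coeff_mul_C, coeff_map, coeff_smul, ← Algebra.smul_def]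
    rw [← Finset.sum_subset (Finset.Icc_subset_Icc_right (Nat.sub_le N 1))
      (fun k hk hk' => ?_)]
    · rw [← Finset.sum_subset (s₁ := Finset.Icc 1 (N - 1)) (fun k hk => ?_) (fun k hk hk' => ?_)]
      · refine Finset.sum_congr rfl fun k hk => ?_
        obtain ⟨m, rfl⟩ := Nat.exists_eq_succ_of_ne_zero
          (Nat.one_le_iff_ne_zero.1 (Finset.mem_Icc.1 hk).1)
        congr 1
        rw [Nat.succ_eq_add_one, coeff_one_descPochhammer_succ, Nat.factorial_succ, smul_eq_mul]
        have h1 : ((m + 1 : ℕ) : K) ≠ 0 := Nat.cast_ne_zero.2 m.succ_ne_zero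
        have h2 : (m.factorial : K) ≠ 0 := Nat.cast_ne_zero.2 m.factorial_ne_zero
        rw [Nat.cast_mul]
        field_simp
        ring
      · simp only [Finset.mem_Icc, Finset.mem_range] at hk ⊢
        omega
      · have : k = 0 := by
          simp only [Finset.mem_Icc, Finset.mem_range] at hk hk'
          omega
        subst this
        simp [coeff_one]
    · have : k = N := by
        simp only [Finset.mem_Icc] at hk hk'
        omega
      rw [this, hN, smul_zero]

namespace InterpolatesOrbit

open Polynomial

variable {K A : Type*} [Field K] [Ring A] [Algebra K A] {σ : A ≃ₐ[K] A} {a b : A} {p q : A[X]}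

theorem unique [CharZero K] (hp : InterpolatesOrbit σ a p) (hq : InterpolatesOrbit σ a q) :
    p = q :=
  sub_eq_zero.1 <| polynomial_eq_zero_of_eval_natCast_eq_zero (K := K) _ fun n => by
    rw [eval_sub, hp n, hq n, sub_self]

theorem add (hp : InterpolatesOrbit σ a p) (hq : InterpolatesOrbit σ b q) :
    InterpolatesOrbit σ (a + b) (p + q) := fun n => by
  rw [eval_add, hp n, hq n, map_add]

theorem smul (c : K) (hp : InterpolatesOrbit σ a p) : InterpolatesOrbit σ (c • a) (c • p) :=
  fun n => by rw [eval_smul, hp n, map_smul]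

theorem mul (hp : InterpolatesOrbit σ a p) (hq : InterpolatesOrbit σ b q) :
    InterpolatesOrbit σ (a * b) (p * q) := fun n => by
  rw [eval_natCast_mul_of_ring, hp n, hq n, map_mul]

theorem map_pow (m : ℕ) (hp : InterpolatesOrbit σ a p) :
    InterpolatesOrbit σ ((σ ^ m) a) (p.map ((σ ^ m : A ≃ₐ[K] A) : A →+* A)) := fun n => by
  rw [eval_natCast_map, hp n]
  change (σ ^ m * σ ^ n) a = (σ ^ n * σ ^ m) a
  rw [← pow_add, ← pow_add, add_comm]

theorem taylor (m : ℕ) (hp : InterpolatesOrbit σ a p) :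
    InterpolatesOrbit σ ((σ ^ m) a) (Polynomial.taylor (m : A) p) := fun n => by
  rw [eval_natCast_taylor_natCast, hp, pow_add, AlgEquiv.mul_apply]

theorem coeff_zero (hp : InterpolatesOrbit σ a p) : p.coeff 0 = a := by
  simpa [coeff_zero_eq_eval_zero] using hp 0

theorem derivative [CharZero K] (hp : InterpolatesOrbit σ a p) :
    InterpolatesOrbit σ (p.coeff 1) (Polynomial.derivative p) := fun n => by
  rw [← taylor_coeff_one, (hp.taylor n).unique (hp.map_pow n), coeff_map]
  rfl

end InterpolatesOrbit


/-- if `σ ∈ Aut_K(A)` with `σ - id` locally nilpotent, then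
`δ := Σ_{k≥1} (-1)^{k+1} (σ - id)^k / k` is a locally nilpotent `K`-derivation
of `A` with `σ = e^δ`. -/
theorem stmt12 {K A : Type*} [Field K] [CharZero K] [Ring A] [Algebra K A]
    (σ : A ≃ₐ[K] A)
    (hln : ∀ a : A, ∃ n : ℕ, (fun b : A => σ b - b)^[n] a = 0)
    (δ : A → A)
    (hδ : ∀ (a : A) (N : ℕ), (fun b : A => σ b - b)^[N] a = 0 →
      δ a = ∑ k ∈ Finset.Icc 1 N,
        ((-1 : K) ^ (k + 1) * ((k : K)⁻¹)) • (fun b : A => σ b - b)^[k] a) :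
    (∀ a b : A, δ (a + b) = δ a + δ b) ∧
    (∀ (c : K) (a : A), δ (c • a) = c • δ a) ∧
    (∀ a b : A, δ (a * b) = δ a * b + a * δ b) ∧
    (∀ a : A, ∃ n : ℕ, δ^[n] a = 0) ∧
    (∀ (a : A) (N : ℕ), δ^[N] a = 0 →
      σ a = ∑ k ∈ Finset.range N, ((Nat.factorial k : K)⁻¹) • δ^[k] a) := by
  have hex : ∀ a : A, ∃ p : Polynomial A, InterpolatesOrbit σ a p ∧ p.coeff 1 = δ a := fun a => by
    obtain ⟨N, hN⟩ := hln a
    rw [hδ a N hN]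
    exact exists_interpolatesOrbit σ a N hN
  have hcoeff : ∀ (a : A) (p : Polynomial A), InterpolatesOrbit σ a p → δ a = p.coeff 1 :=
    fun a p hp => by
      obtain ⟨q, hq, hq1⟩ := hex a
      rw [← hq1, hq.unique hp]
  have hiter : ∀ (a : A) (p : Polynomial A), InterpolatesOrbit σ a p →
      ∀ k : ℕ, δ^[k] a = (k.factorial : K) • p.coeff k := fun a p hp k => by
    have h : ∀ k : ℕ, InterpolatesOrbit σ (δ^[k] a) (Polynomial.derivative^[k] p) := fun k => by
      induction k with
      | zero => exact hp
      | succ k ih =>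
        rw [Function.iterate_succ_apply', Function.iterate_succ_apply', hcoeff _ _ ih]
        exact ih.derivative
    rw [← (h k).coeff_zero, Polynomial.coeff_iterate_derivative, zero_add,
      Nat.descFactorial_self, Nat.cast_smul_eq_nsmul]
  refine ⟨fun a b => ?_, fun c a => ?_, fun a b => ?_, fun a => ?_, fun a N hN => ?_⟩
  · obtain ⟨p, hp, hp1⟩ := hex a
    obtain ⟨q, hq, hq1⟩ := hex b
    rw [hcoeff _ _ (hp.add hq), Polynomial.coeff_add, hp1, hq1]
  · obtain ⟨p, hp, hp1⟩ := hex a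
    rw [hcoeff _ _ (hp.smul c), Polynomial.coeff_smul, hp1]
  · obtain ⟨p, hp, hp1⟩ := hex a
    obtain ⟨q, hq, hq1⟩ := hex b
    rw [hcoeff _ _ (hp.mul hq), Polynomial.mul_coeff_one, hp1, hq1, hp.coeff_zero, hq.coeff_zero,
      add_comm]
  · obtain ⟨p, hp, -⟩ := hex a
    exact ⟨p.natDegree + 1, by
      rw [hiter a p hp, Polynomial.coeff_eq_zero_of_natDegree_lt (Nat.lt_succ_self _), smul_zero]⟩
  · obtain ⟨p, hp, -⟩ := hex a
    have hfac : ∀ k : ℕ, ((k.factorial : K)⁻¹) • δ^[k] a = p.coeff k := fun k => by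
      rw [hiter a p hp, inv_smul_smul₀ (Nat.cast_ne_zero.2 k.factorial_ne_zero)]
    have hδ0 : δ 0 = 0 := by
      rw [hδ 0 0 rfl, Finset.Icc_eq_empty (by decide), Finset.sum_empty]
    have hvan : ∀ k, N ≤ k → p.coeff k = 0 := fun k hk => by
      rw [← hfac, ← Nat.sub_add_cancel hk, Function.iterate_add_apply, hN,
        Function.iterate_fixed hδ0, smul_zero]
    have hσ : σ a = p.eval 1 := by simpa using (hp 1).symm
    simp only [hfac]
    rw [hσ, Polynomial.eval_eq_sum_range'
      (lt_of_lt_of_le (Nat.lt_succ_self p.natDegree) (le_max_right N _))]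
    simp only [one_pow, mul_one]
    exact (Finset.sum_subset (Finset.range_mono (le_max_left _ _)) fun k _ hk =>
      hvan k (by simpa using hk)).symm
end
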